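/- Let R be a commutative ring, D : R → R a derivation, and c ∈ R. Extend D to R[X] by acting on coefficients (D(Σ aᵢ Xⁱ) = Σ D(aᵢ) Xⁱ). For k ∈ R define the operator ∇_k : R[X] → R[X] by ∇_k f = D f − (X² − c) · f′ + k · X · f, where f′ is the formal derivative, and let ε : R[X] → R[X] be ε f = f′. Then for every f ∈ R[X]: ε(∇_k f) − ∇_{k−2}(ε f) = k · f, where k − 2 means k − 2·1_R. -/

import Mathlib

open Polynomial

/-- The Gauss–Manin connection in local coordinates. -/
noncomputable def nabla {R : Type*} [CommRing R]
    (Dp : R[X] → R[X]) (c k : R) (f : R[X]) : R[X] :=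
  Dp f - (X ^ 2 - C c) * derivative f + C k * X * f

/-- An additive map applied coefficientwise commutes with the formal derivative. -/
theorem derivative_comm_of_coeff {R : Type*} [CommRing R] (D : R → R)
    (hadd : ∀ x y, D (x + y) = D x + D y) (Dp : R[X] → R[X])
    (hDp : ∀ (f : R[X]) (i : ℕ), (Dp f).coeff i = D (f.coeff i)) (f : R[X]) :
    derivative (Dp f) = Dp (derivative f) := by
  ext i
  have h := map_nsmul (AddMonoidHom.mk' D hadd) (i + 1) (f.coeff (i + 1))
  simp only [AddMonoidHom.mk'_apply, nsmul_eq_mul, Nat.cast_add, Nat.cast_one] at h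
  rw [hDp, coeff_derivative, coeff_derivative, hDp, mul_comm, ← h, mul_comm]

/-- Commutation relation between the projection ε and the connection ∇. -/
theorem stmt5 (R : Type*) [CommRing R] (D : R → R)
    (hadd : ∀ x y, D (x + y) = D x + D y)
    (hmul : ∀ x y, D (x * y) = D x * y + x * D y)
    (Dp : R[X] → R[X])
    (hDp : ∀ (f : R[X]) (i : ℕ), (Dp f).coeff i = D (f.coeff i))
    (c k : R) (f : R[X]) :
    derivative (nabla Dp c k f) - nabla Dp c (k - 2) (derivative f) = C k * f := by
  simp only [nabla, ← derivative_comm_of_coeff D hadd Dp hDp f, derivative_add, derivative_sub,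
    derivative_mul, derivative_X_pow, derivative_C, derivative_X, C_sub]
  have h2 : (C 2 : R[X]) = 2 := map_ofNat C 2
  simp only [h2, Nat.cast_ofNat]
  ring
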